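/- arXiv:2510.26938 — 2 statements merged into one kernel-verified Lean document; each statement's English description precedes it below -/
import Mathlib

section
/- Let G be a finite simple graph without isolated vertices and let k be a positive integer. Then G can be transformed into a constellation by a sequence of at most k exclusive vertex splits if and only if G admits a star decomposition P with wgt(P) ≤ |V(G)| + k. -/
open SimpleGraph

/-- Inclusive vertex split of the vertex `u` of `G`.  The resulting graph `G'` lives on
vertex set `Option V`, where `some u` plays the role of the first copy `v₁` of `u` and
`none` plays the role of the second copy `v₂`; every other vertex `x` is represented by
`some x`, with all adjacencies among such vertices unchanged.  The neighborhoods of the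
two copies are contained in `N(u)` and their union is `N(u)`; the two copies are not
adjacent to each other. -/
def IsInclusiveSplit {V : Type} (G : SimpleGraph V) (G' : SimpleGraph (Option V))
    (u : V) : Prop :=
  (∀ x y : V, x ≠ u → y ≠ u → (G'.Adj (some x) (some y) ↔ G.Adj x y)) ∧
  (¬ G'.Adj (some u) none) ∧
  (∀ x : V, G'.Adj (some u) (some x) → G.Adj u x) ∧
  (∀ x : V, G'.Adj none (some x) → G.Adj u x) ∧
  (∀ x : V, G.Adj u x → (G'.Adj (some u) (some x) ∨ G'.Adj none (some x)))

/-- Exclusive vertex split: an inclusive split in which the neighborhoods of the two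
copies are disjoint (they partition `N(u)`). -/
def IsExclusiveSplit {V : Type} (G : SimpleGraph V) (G' : SimpleGraph (Option V))
    (u : V) : Prop :=
  IsInclusiveSplit G G' u ∧
  ∀ x : V, ¬ (G'.Adj (some u) (some x) ∧ G'.Adj none (some x))

/-- `InclReach P k V G` : the graph `G` can be transformed, by a sequence of **at most**
`k` inclusive vertex splits, into a graph satisfying the property `P`. -/
def InclReach (P : (W : Type) → SimpleGraph W → Prop) :
    (k : ℕ) → (V : Type) → SimpleGraph V → Prop
  | 0, V, G => P V G
  | k+1, V, G => P V G ∨ ∃ (u : V) (G' : SimpleGraph (Option V)),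
      IsInclusiveSplit G G' u ∧ InclReach P k (Option V) G'

/-- `ExclReach P k V G` : the graph `G` can be transformed, by a sequence of **at most**
`k` exclusive vertex splits, into a graph satisfying the property `P`. -/
def ExclReach (P : (W : Type) → SimpleGraph W → Prop) :
    (k : ℕ) → (V : Type) → SimpleGraph V → Prop
  | 0, V, G => P V G
  | k+1, V, G => P V G ∨ ∃ (u : V) (G' : SimpleGraph (Option V)),
      IsExclusiveSplit G G' u ∧ ExclReach P k (Option V) G'

/-- The vertex type obtained from `V` after `k` vertex splits. -/
def IterOpt : ℕ → Type → Type
  | 0, V => V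
  | k+1, V => IterOpt k (Option V)

/-- `InclSeq k V G G'` : `G'` is obtained from `G` by a sequence of **exactly** `k`
inclusive vertex splits. -/
def InclSeq : (k : ℕ) → (V : Type) → SimpleGraph V → SimpleGraph (IterOpt k V) → Prop
  | 0, _V, G, G' => G' = G
  | k+1, V, G, G' => ∃ (u : V) (G₁ : SimpleGraph (Option V)),
      IsInclusiveSplit G G₁ u ∧ InclSeq k (Option V) G₁ G'

/-- `ExclSeq k V G G'` : `G'` is obtained from `G` by a sequence of **exactly** `k`
exclusive vertex splits. -/
def ExclSeq : (k : ℕ) → (V : Type) → SimpleGraph V → SimpleGraph (IterOpt k V) → Prop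
  | 0, _V, G, G' => G' = G
  | k+1, V, G, G' => ∃ (u : V) (G₁ : SimpleGraph (Option V)),
      IsExclusiveSplit G G₁ u ∧ ExclSeq k (Option V) G₁ G'

/-- A (single) cycle: a connected graph in which every vertex has degree exactly 2. -/
def IsSingleCycle {W : Type} (G : SimpleGraph W) : Prop :=
  G.Connected ∧ ∀ v : W, (G.neighborSet v).ncard = 2

/-- A cycle graph: a disjoint union of cycles, i.e. every connected component is a cycle. -/
def IsCycleGraph {W : Type} (G : SimpleGraph W) : Prop :=
  ∀ C : G.ConnectedComponent, IsSingleCycle (G.induce C.supp)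

/-- A star: a single central vertex adjacent to all other vertices, with no other edges. -/
def IsStarGraph {W : Type} (G : SimpleGraph W) : Prop :=
  ∃ c : W, ∀ v w : W, G.Adj v w ↔ ((v = c ∧ w ≠ c) ∨ (w = c ∧ v ≠ c))

/-- A constellation: a disjoint union of stars, i.e. every connected component is a star. -/
def IsConstellation {W : Type} (G : SimpleGraph W) : Prop :=
  ∀ C : G.ConnectedComponent, IsStarGraph (G.induce C.supp)

/-- A linear forest: every connected component is a path with at least one edge.
Equivalently (for finite graphs): acyclic, maximum degree at most 2,
and no isolated vertices. -/
def IsLinearForest {W : Type} (G : SimpleGraph W) : Prop :=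
  G.IsAcyclic ∧ (∀ v : W, (G.neighborSet v).ncard ≤ 2) ∧ (∀ v : W, ∃ w, G.Adj v w)

/-- The weight of a set of subgraphs: the sum of the numbers of vertices of its members. -/
noncomputable def wgt {V : Type} {G : SimpleGraph V} (P : Finset G.Subgraph) : ℕ :=
  ∑ H ∈ P, H.verts.ncard

/-- The edge sets of the members of `P` form a partition of the edge set of `G`:
every edge of `G` lies in exactly one member of `P`. -/
def IsEdgeDecomposition {V : Type} {G : SimpleGraph V} (P : Finset G.Subgraph) : Prop :=
  ∀ e ∈ G.edgeSet, ∃! H : G.Subgraph, H ∈ P ∧ e ∈ H.edgeSet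

/-- A star decomposition of `G`: a set of subgraphs of `G`, each of which is a star
(with a nonempty edge set, as parts of a partition are nonempty), whose edge sets
partition `E(G)`. -/
def IsStarDecomposition {V : Type} {G : SimpleGraph V} (P : Finset G.Subgraph) : Prop :=
  (∀ H ∈ P, H.edgeSet.Nonempty ∧ IsStarGraph H.coe) ∧ IsEdgeDecomposition P

/-- A `Γ`-decomposition of `G`, where `Γ` is a family of graphs: a set of subgraphs of
`G`, each isomorphic to a member of `Γ` (with a nonempty edge set, as parts of a
partition are nonempty), whose edge sets partition `E(G)`. -/
def IsGammaDecomposition {V ι : Type} (Γ : ι → (W : Type) × SimpleGraph W)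
    {G : SimpleGraph V} (P : Finset G.Subgraph) : Prop :=
  (∀ H ∈ P, H.edgeSet.Nonempty ∧ ∃ i : ι, Nonempty (H.coe ≃g (Γ i).2)) ∧
  IsEdgeDecomposition P

/-- `G` is a disjoint union of graphs of the family `Γ`: every connected component of
`G` is isomorphic to a member of `Γ`. -/
def IsDisjointUnionOf {V ι : Type} (Γ : ι → (W : Type) × SimpleGraph W)
    (G : SimpleGraph V) : Prop :=
  ∀ C : G.ConnectedComponent, ∃ i : ι, Nonempty ((G.induce C.supp) ≃g (Γ i).2)
/-- `π` exhibits `H` as a graph obtained from `G` by splitting vertices exclusively: it is a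
surjective homomorphism under which every dart of `G` has a unique lift. -/
structure IsDartCover {W V : Type} (H : SimpleGraph W) (G : SimpleGraph V) (π : W → V) :
    Prop where
  surjective : Function.Surjective π
  map_adj : ∀ {a b}, H.Adj a b → G.Adj (π a) (π b)
  exists_lift : ∀ {x y}, G.Adj x y → ∃ a b, H.Adj a b ∧ π a = x ∧ π b = y
  lift_unique : ∀ {a b a' b'}, H.Adj a b → H.Adj a' b' → π a = π a' → π b = π b' →
    a = a' ∧ b = b'

namespace IsDartCover

variable {U V W : Type} {K : SimpleGraph U} {H : SimpleGraph W} {G : SimpleGraph V}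

theorem id (G : SimpleGraph V) : IsDartCover G G _root_.id where
  surjective := Function.surjective_id
  map_adj h := h
  exists_lift {x y} h := ⟨x, y, h, rfl, rfl⟩
  lift_unique _ _ h₁ h₂ := ⟨h₁, h₂⟩

theorem comp {ρ : U → W} {π : W → V} (hπ : IsDartCover H G π) (hρ : IsDartCover K H ρ) :
    IsDartCover K G (π ∘ ρ) where
  surjective := hπ.surjective.comp hρ.surjective
  map_adj h := hπ.map_adj (hρ.map_adj h)
  exists_lift h := by
    obtain ⟨a, b, hab, rfl, rfl⟩ := hπ.exists_lift h
    obtain ⟨c, d, hcd, rfl, rfl⟩ := hρ.exists_lift hab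
    exact ⟨c, d, hcd, rfl, rfl⟩
  lift_unique h h' h₁ h₂ := by
    obtain ⟨e₁, e₂⟩ := hπ.lift_unique (hρ.map_adj h) (hρ.map_adj h') h₁ h₂
    exact hρ.lift_unique h h' e₁ e₂

/-- An injective dart cover is an isomorphism. -/
theorem nonempty_iso {π : W → V} (hπ : IsDartCover H G π) (hinj : Function.Injective π) :
    Nonempty (H ≃g G) := by
  refine ⟨⟨Equiv.ofBijective π ⟨hinj, hπ.surjective⟩, ?_⟩⟩
  intro a b
  refine ⟨fun h => ?_, fun h => hπ.map_adj h⟩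
  obtain ⟨c, d, hcd, h₁, h₂⟩ := hπ.exists_lift h
  rwa [hinj h₁, hinj h₂] at hcd

end IsDartCover

/-- The map merging the new vertex of a split of `u` with `u`. -/
def mergeNew {V : Type} (u : V) (p : Option V) : V := p.getD u

theorem isExclusiveSplit_iff_isDartCover {V : Type} {G : SimpleGraph V}
    {G' : SimpleGraph (Option V)} {u : V} :
    IsExclusiveSplit G G' u ↔ IsDartCover G' G (mergeNew u) := by
  constructor
  · rintro ⟨⟨h₁, h₂, h₃, h₄, h₅⟩, h₆⟩
    have hmap : ∀ {a b}, G'.Adj a b → G.Adj (mergeNew u a) (mergeNew u b) := by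
      intro a b hab
      rcases a with _ | x <;> rcases b with _ | y <;> simp only [mergeNew, Option.getD]
      · exact (G'.irrefl hab).elim
      · exact h₄ y hab
      · exact (h₄ x hab.symm).symm
      · by_cases hx : x = u
        · subst hx; exact h₃ y hab
        · by_cases hy : y = u
          · subst hy; exact (h₃ x hab.symm).symm
          · exact (h₁ x y hx hy).1 hab
    have hcopy : ∀ {a a' : Option V} {x : V}, G'.Adj a (some x) → G'.Adj a' (some x) →
        mergeNew u a = mergeNew u a' → a = a' := by
      intro a a' x ha ha' he
      rcases a with _ | y <;> rcases a' with _ | z <;> simp only [mergeNew, Option.getD] at he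
      · rfl
      · subst he; exact (h₆ x ⟨ha', ha⟩).elim
      · subst he; exact (h₆ x ⟨ha, ha'⟩).elim
      · rw [he]
    have hne : ∀ {b : Option V}, mergeNew u b ≠ u → b = some (mergeNew u b) := by
      intro b hb
      cases b <;> simp_all [mergeNew]
    refine ⟨fun v => ⟨some v, rfl⟩, hmap, ?_, ?_⟩
    · intro x y hxy
      by_cases hx : x = u
      · subst hx
        rcases h₅ y hxy with h | h
        · exact ⟨_, _, h, rfl, rfl⟩
        · exact ⟨_, _, h, rfl, rfl⟩
      · by_cases hy : y = u
        · subst hy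
          rcases h₅ x hxy.symm with h | h
          · exact ⟨_, _, h.symm, rfl, rfl⟩
          · exact ⟨_, _, h.symm, rfl, rfl⟩
        · exact ⟨some x, some y, (h₁ x y hx hy).2 hxy, rfl, rfl⟩
    · intro a b a' b' h h' ha hb
      by_cases hbu : mergeNew u b = u
      · have hau : mergeNew u a ≠ u := fun e => (hmap h).ne (e.trans hbu.symm)
        have e : a = a' := (hne hau).trans (ha ▸ (hne (ha ▸ hau)).symm)
        subst e
        rw [hne hau] at h h'
        exact ⟨rfl, hcopy h.symm h'.symm hb⟩
      · have e : b = b' := (hne hbu).trans (hb ▸ (hne (hb ▸ hbu)).symm)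
        subst e
        rw [hne hbu] at h h'
        exact ⟨hcopy h h' ha, rfl⟩
  · intro hc
    refine ⟨⟨fun x y hx hy => ⟨fun h => hc.map_adj h, fun h => ?_⟩, fun h => (hc.map_adj h).ne rfl,
      fun x h => hc.map_adj h, fun x h => hc.map_adj h, fun x h => ?_⟩, fun x h => ?_⟩
    · obtain ⟨a, b, hab, rfl, rfl⟩ := hc.exists_lift h
      rcases a with _ | a
      · exact (hx rfl).elim
      · rcases b with _ | b
        · exact (hy rfl).elim
        · exact hab
    · obtain ⟨a, b, hab, ha, rfl⟩ := hc.exists_lift h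
      rcases b with _ | b
      · exact (h.ne rfl).elim
      · rcases a with _ | a
        · exact Or.inr hab
        · obtain rfl : a = u := ha
          exact Or.inl hab
    · simpa using (hc.lift_unique h.1 h.2 rfl rfl).1

/-- A non-injective dart cover factors through a single exclusive split. -/
theorem IsDartCover.exists_split {V W : Type} {H : SimpleGraph W} {G : SimpleGraph V} {π : W → V}
    (hπ : IsDartCover H G π) (hinj : ¬ Function.Injective π) :
    ∃ (u : V) (G' : SimpleGraph (Option V)) (π' : W → Option V),
      IsExclusiveSplit G G' u ∧ IsDartCover H G' π' := by
  classical
  simp only [Function.Injective, not_forall] at hinj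
  obtain ⟨a, b, hab, hne⟩ := hinj
  set π' : W → Option V := fun w => if w = a then none else some (π w) with hπ'
  have hmerge : ∀ w, mergeNew (π a) (π' w) = π w := by
    intro w
    by_cases hw : w = a <;> simp [hπ', hw, mergeNew]
  let G' : SimpleGraph (Option V) :=
    { Adj := fun p q => ∃ c d, H.Adj c d ∧ π' c = p ∧ π' d = q
      symm := ⟨by
        rintro p q ⟨c, d, h, hc, hd⟩
        exact ⟨d, c, h.symm, hd, hc⟩⟩
      loopless := ⟨by
        rintro p ⟨c, d, h, hc, hd⟩
        refine (hπ.map_adj h).ne ?_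
        rw [← hmerge c, ← hmerge d, hc, hd]⟩ }
  refine ⟨π a, G', π', isExclusiveSplit_iff_isDartCover.2 ?_, ?_⟩
  · refine ⟨fun v => ⟨some v, rfl⟩, ?_, ?_, ?_⟩
    · rintro p q ⟨c, d, h, rfl, rfl⟩
      rw [hmerge, hmerge]
      exact hπ.map_adj h
    · intro x y hxy
      obtain ⟨c, d, h, rfl, rfl⟩ := hπ.exists_lift hxy
      exact ⟨_, _, ⟨c, d, h, rfl, rfl⟩, hmerge c, hmerge d⟩
    · rintro p q p' q' ⟨c, d, h, rfl, rfl⟩ ⟨c', d', h', rfl, rfl⟩ h₁ h₂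
      rw [hmerge, hmerge] at h₁ h₂
      obtain ⟨rfl, rfl⟩ := hπ.lift_unique h h' h₁ h₂
      exact ⟨rfl, rfl⟩
  · refine ⟨?_, fun {c d} h => ⟨c, d, h, rfl, rfl⟩, fun h => h, ?_⟩
    · rintro (_ | v)
      · exact ⟨a, by simp [hπ']⟩
      · obtain ⟨w, rfl⟩ := hπ.surjective v
        by_cases hw : w = a
        · subst hw
          exact ⟨b, by simp [hπ', Ne.symm hne, hab]⟩
        · exact ⟨w, by simp [hπ', hw]⟩
    · intro c d c' d' h h' h₁ h₂
      refine hπ.lift_unique h h' ?_ ?_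
      · rw [← hmerge c, h₁, hmerge]
      · rw [← hmerge d, h₂, hmerge]

/-- The graphs reachable by at most `k` exclusive splits are the dart covers with at most `k`
additional vertices. -/
theorem exclReach_iff_exists_isDartCover {P : (W : Type) → SimpleGraph W → Prop}
    (hP : ∀ {W V : Type} {H : SimpleGraph W} {G : SimpleGraph V}, Nonempty (H ≃g G) → P W H → P V G)
    {k : ℕ} {V : Type} [Finite V] {G : SimpleGraph V} :
    ExclReach P k V G ↔ ∃ (W : Type) (H : SimpleGraph W) (π : W → V),
      Finite W ∧ IsDartCover H G π ∧ P W H ∧ Nat.card W ≤ Nat.card V + k := by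
  induction k generalizing V with
  | zero =>
    refine ⟨fun h => ⟨V, G, _, inferInstance, .id G, h, le_rfl⟩, ?_⟩
    rintro ⟨W, H, π, _, hπ, hH, hcard⟩
    exact hP (hπ.nonempty_iso
      ((Function.Surjective.bijective_of_nat_card_le hπ.surjective hcard).1)) hH
  | succ k ih =>
    constructor
    · rintro (h | ⟨u, G', hs, h⟩)
      · exact ⟨V, G, _, inferInstance, .id G, h, Nat.le_add_right _ _⟩
      · obtain ⟨W, H, π, hW, hπ, hH, hcard⟩ := ih.1 h
        refine ⟨W, H, _, hW, (isExclusiveSplit_iff_isDartCover.1 hs).comp hπ, hH, ?_⟩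
        rw [Finite.card_option] at hcard
        omega
    · rintro ⟨W, H, π, hW, hπ, hH, hcard⟩
      by_cases hinj : Function.Injective π
      · exact Or.inl (hP (hπ.nonempty_iso hinj) hH)
      · obtain ⟨u, G', π', hs, hπ'⟩ := hπ.exists_split hinj
        refine Or.inr ⟨u, G', hs, ih.2 ⟨W, H, π', hW, hπ', hH, ?_⟩⟩
        rw [Finite.card_option]
        omega

/-- A constellation is a graph whose vertices can be mapped to centers, so that two vertices are
adjacent iff they are distinct, share their center, and one of them is that center. -/
theorem isConstellation_iff_exists_center {W : Type} {H : SimpleGraph W} :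
    IsConstellation H ↔ ∃ r : W → W, (∀ v, r (r v) = r v) ∧
      ∀ v w, H.Adj v w ↔ r v = r w ∧ v ≠ w ∧ (v = r v ∨ w = r w) := by
  constructor
  · intro h
    obtain ⟨z, hz, hadj⟩ : ∃ z : H.ConnectedComponent → W,
        (∀ C, H.connectedComponentMk (z C) = C) ∧
        ∀ v w, H.connectedComponentMk v = H.connectedComponentMk w →
          (H.Adj v w ↔ v ≠ w ∧
            (v = z (H.connectedComponentMk v) ∨ w = z (H.connectedComponentMk w))) := by
      choose c hc using h
      refine ⟨fun C => c C, fun C => (c C).2, fun v w e => ?_⟩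
      have := hc (H.connectedComponentMk v) ⟨v, rfl⟩ ⟨w, e.symm⟩
      simp only [SimpleGraph.comap_adj, Function.Embedding.subtype_apply, Subtype.ext_iff,
        ne_eq] at this
      rw [this]
      grind
    refine ⟨fun v => z (H.connectedComponentMk v), fun v => congrArg z (hz _), fun v w => ?_⟩
    constructor
    · intro hvw
      have e := SimpleGraph.ConnectedComponent.connectedComponentMk_eq_of_adj hvw
      exact ⟨congrArg z e, (hadj v w e).1 hvw⟩
    · rintro ⟨e, h⟩
      refine (hadj v w ?_).2 h
      exact (hz _).symm.trans ((congrArg H.connectedComponentMk e).trans (hz _))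
  · rintro ⟨r, hr, hadj⟩ C
    induction C using SimpleGraph.ConnectedComponent.ind with
    | _ z =>
    have hconst : ∀ {v w}, H.Reachable v w → r v = r w := by
      rintro v w ⟨p⟩
      induction p with
      | nil => rfl
      | cons h _ ih => exact ((hadj _ _).1 h).1.trans ih
    have hz : H.Reachable (r z) z := by
      by_cases e : r z = z
      · rw [e]
      · exact ((hadj _ _).2 ⟨hr z, e, Or.inl (hr z).symm⟩).reachable
    refine ⟨⟨r z, SimpleGraph.ConnectedComponent.sound hz⟩, ?_⟩
    rintro ⟨v, hv⟩ ⟨w, hw⟩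
    have ev := hconst (SimpleGraph.ConnectedComponent.exact hv)
    have ew := hconst (SimpleGraph.ConnectedComponent.exact hw)
    simp only [SimpleGraph.comap_adj, Function.Embedding.subtype_apply, hadj, ev, ew,
      Subtype.ext_iff, ne_eq]
    grind

theorem IsConstellation.of_iso {W V : Type} {H : SimpleGraph W} {G : SimpleGraph V}
    (e : Nonempty (H ≃g G)) (h : IsConstellation H) : IsConstellation G := by
  obtain ⟨e⟩ := e
  rw [isConstellation_iff_exists_center] at h ⊢
  obtain ⟨r, hr, hadj⟩ := h
  refine ⟨fun v => e (r (e.symm v)), fun v => by simp [hr], fun v w => ?_⟩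
  have := hadj (e.symm v) (e.symm w)
  rw [e.symm.map_adj_iff] at this
  rw [this, e.injective.eq_iff, e.symm.injective.ne_iff,
    RelIso.symm_apply_eq, RelIso.symm_apply_eq]

/-- The image in `G` of the vertices of `H` with center `c`. -/
def IsDartCover.starImage {W V : Type} {H : SimpleGraph W} {G : SimpleGraph V} {π : W → V}
    (hπ : IsDartCover H G π) (r : W → W) (hr : ∀ {a b}, H.Adj a b → r a = r b) (c : W) :
    G.Subgraph where
  verts := π '' {a | r a = c}
  Adj x y := ∃ a b, r a = c ∧ H.Adj a b ∧ π a = x ∧ π b = y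
  adj_sub := by
    rintro x y ⟨a, b, -, h, rfl, rfl⟩
    exact hπ.map_adj h
  edge_vert := by
    rintro x y ⟨a, b, h, -, rfl, rfl⟩
    exact ⟨a, h, rfl⟩
  symm := ⟨by
    rintro x y ⟨a, b, h, hab, rfl, rfl⟩
    exact ⟨b, a, (hr hab).symm.trans h, hab.symm, rfl, rfl⟩⟩

theorem IsDartCover.exists_starDecomposition {W V : Type} [Finite W] {H : SimpleGraph W}
    {G : SimpleGraph V} {π : W → V} (hπ : IsDartCover H G π) (hH : IsConstellation H) :
    ∃ P : Finset G.Subgraph, IsStarDecomposition P ∧ wgt P ≤ Nat.card W := by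
  classical
  have := Fintype.ofFinite W
  obtain ⟨r, hr, hadj⟩ := isConstellation_iff_exists_center.1 hH
  have hr' : ∀ {a b}, H.Adj a b → r a = r b := fun h => ((hadj _ _).1 h).1
  let S := hπ.starImage r hr'
  refine ⟨(Finset.univ.image S).filter fun K => K.edgeSet.Nonempty, ⟨?_, ?_⟩, ?_⟩
  · intro K hK
    obtain ⟨hK, hne⟩ := Finset.mem_filter.1 hK
    obtain ⟨c, -, rfl⟩ := Finset.mem_image.1 hK
    refine ⟨hne, ?_⟩
    have hc : r c = c := by
      obtain ⟨e, he⟩ := hne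
      induction e with
      | _ x y =>
      obtain ⟨a, b, rfl, -⟩ := he
      exact hr a
    have hto : ∀ {a}, r a = c → a ≠ c → H.Adj c a := fun {a} ha hne =>
      (hadj _ _).2 ⟨hc.trans ha.symm, hne.symm, Or.inl hc.symm⟩
    have hinj : ∀ {a}, r a = c → π a = π c → a = c := by
      intro a ha h
      by_contra hac
      exact (hπ.map_adj (hto ha hac)).ne h.symm
    refine ⟨⟨π c, c, hc, rfl⟩, ?_⟩
    rintro ⟨x, a, ha, rfl⟩ ⟨y, b, hb, rfl⟩
    simp only [SimpleGraph.Subgraph.coe_adj, Subtype.ext_iff, ne_eq]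
    simp only [Set.mem_ofPred_eq] at ha hb
    constructor
    · rintro ⟨a', b', ha', hab, h₁, h₂⟩
      have hxy := (hπ.map_adj hab).ne
      obtain ⟨e, -, h | h⟩ := (hadj _ _).1 hab
      · left
        rw [ha'] at h
        subst h
        exact ⟨h₁.symm, fun h => hxy (h₂.trans h).symm⟩
      · right
        rw [← e, ha'] at h
        subst h
        exact ⟨h₂.symm, fun h => hxy (h₁.trans h)⟩
    · rintro (⟨h₁, h₂⟩ | ⟨h₁, h₂⟩)
      · exact ⟨c, b, hc, hto hb fun h => h₂ (by rw [h]), h₁.symm, rfl⟩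
      · exact ⟨a, c, ha, (hto ha fun h => h₂ (by rw [h])).symm, rfl, h₁.symm⟩
  · intro e he
    induction e with
    | _ x y =>
    obtain ⟨a, b, hab, hx, hy⟩ := hπ.exists_lift he
    have hmem : s(x, y) ∈ (S (r a)).edgeSet := ⟨a, b, rfl, hab, hx, hy⟩
    refine ⟨S (r a), ⟨?_, hmem⟩, ?_⟩
    · exact Finset.mem_filter.2 ⟨Finset.mem_image_of_mem _ (Finset.mem_univ _), ⟨_, hmem⟩⟩
    · rintro K ⟨hK, hxy⟩
      obtain ⟨c, -, rfl⟩ := Finset.mem_image.1 (Finset.mem_filter.1 hK).1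
      obtain ⟨a', b', rfl, hab', hx', hy'⟩ := hxy
      rw [(hπ.lift_unique hab hab' (hx.trans hx'.symm) (hy.trans hy'.symm)).1]
  · calc wgt _ ≤ ∑ K ∈ Finset.univ.image S, K.verts.ncard :=
          Finset.sum_le_sum_of_subset (Finset.filter_subset _ _)
      _ ≤ ∑ c : W, (S c).verts.ncard := Finset.sum_image_le_of_nonneg fun _ _ => Nat.zero_le _
      _ ≤ ∑ c : W, (Finset.univ.filter fun a => r a = c).card := by
          refine Finset.sum_le_sum fun c _ => ?_
          refine (Set.ncard_image_le (Set.toFinite _)).trans_eq ?_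
          rw [← Set.ncard_coe_finset]
          simp
      _ = Nat.card W := by
          rw [Nat.card_eq_fintype_card, ← Finset.card_univ]
          exact (Finset.card_eq_sum_card_fiberwise fun _ _ => Finset.mem_univ _).symm

theorem IsStarDecomposition.exists_isDartCover {V : Type} [Finite V] {G : SimpleGraph V}
    (hni : ∀ v : V, ∃ w : V, G.Adj v w) {P : Finset G.Subgraph} (hP : IsStarDecomposition P) :
    ∃ (W : Type) (H : SimpleGraph W) (π : W → V),
      Finite W ∧ IsDartCover H G π ∧ IsConstellation H ∧ Nat.card W = wgt P := by
  classical
  obtain ⟨hstar, hdec⟩ := hP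
  let H : SimpleGraph (Σ K : P, K.1.verts) :=
    { Adj := fun p q => p.1 = q.1 ∧ p.1.1.Adj p.2 q.2
      symm := ⟨by
        rintro ⟨K, v⟩ ⟨_, w⟩ ⟨rfl, h⟩
        exact ⟨rfl, h.symm⟩⟩
      loopless := ⟨fun p h => h.2.ne rfl⟩ }
  have hlift : ∀ {x y}, G.Adj x y → ∃ p q, H.Adj p q ∧ p.2.1 = x ∧ q.2.1 = y := by
    intro x y hxy
    obtain ⟨K, ⟨hK, hKxy⟩, -⟩ := hdec s(x, y) hxy
    rw [SimpleGraph.Subgraph.mem_edgeSet] at hKxy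
    exact ⟨⟨⟨K, hK⟩, x, K.edge_vert hKxy⟩, ⟨⟨K, hK⟩, y, K.edge_vert hKxy.symm⟩, ⟨rfl, hKxy⟩,
      rfl, rfl⟩
  refine ⟨_, H, fun p => p.2.1, inferInstance, ⟨?_, ?_, hlift, ?_⟩, ?_, ?_⟩
  · intro v
    obtain ⟨w, hw⟩ := hni v
    obtain ⟨p, -, -, hp, -⟩ := hlift hw
    exact ⟨p, hp⟩
  · rintro p q ⟨-, h⟩
    exact h.adj_sub
  · rintro ⟨K, v⟩ ⟨_, w⟩ ⟨K', v', hv'⟩ ⟨_, w', hw'⟩ ⟨rfl, h⟩ ⟨rfl, h'⟩ e₁ e₂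
    simp only at e₁ e₂ h h'
    subst e₁ e₂
    have : K = K' := Subtype.ext <|
      (hdec s(v.1, w.1) h.adj_sub).unique ⟨K.2, h⟩ ⟨K'.2, h'⟩
    subst this
    exact ⟨rfl, rfl⟩
  · rw [isConstellation_iff_exists_center]
    choose c hc using fun K : P => (hstar K.1 K.2).2
    refine ⟨fun p => ⟨p.1, c p.1⟩, fun _ => rfl, ?_⟩
    rintro ⟨K, v⟩ ⟨K', w⟩
    by_cases hK : K = K'
    · subst hK
      have := hc K v w
      rw [SimpleGraph.Subgraph.coe_adj] at this
      simp only [H, this, true_and, ne_eq, Sigma.mk.injEq, heq_eq_eq]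
      grind
    · simp [H, hK]
  · rw [Nat.card_sigma]
    simp only [Nat.card_coe_set_eq, wgt]
    exact Finset.sum_coe_sort P fun K => K.verts.ncard

/-- Let `G` be a finite simple graph without isolated vertices and `k`
a positive integer.  Then `G` can be transformed into a constellation by a sequence of
at most `k` exclusive vertex splits iff `G` admits a star decomposition `P` with
`wgt P ≤ |V(G)| + k`. -/
theorem constellationEVS_iff_starDecomposition {V : Type} [Fintype V]
    (G : SimpleGraph V) (hni : ∀ v : V, ∃ w : V, G.Adj v w) (k : ℕ) (hk : 0 < k) :
    ExclReach (fun _ H => IsConstellation H) k V G ↔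
      ∃ P : Finset G.Subgraph, IsStarDecomposition P ∧ wgt P ≤ Fintype.card V + k := by
  rw [exclReach_iff_exists_isDartCover IsConstellation.of_iso, ← Nat.card_eq_fintype_card]
  constructor
  · rintro ⟨W, H, π, _, hπ, hH, hcard⟩
    obtain ⟨P, hP, hwgt⟩ := hπ.exists_starDecomposition hH
    exact ⟨P, hP, hwgt.trans hcard⟩
  · rintro ⟨P, hP, hwgt⟩
    obtain ⟨W, H, π, hW, hπ, hH, hcard⟩ := hP.exists_isDartCover hni
    exact ⟨W, H, π, hW, hπ, hH, hcard.trans_le hwgt⟩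
end

section
/- Let G be a connected finite simple graph with at least two edges, and let W*(G) denote the minimum length of a closed walk in G traversing every edge of G at least once. Then the minimum number of inclusive vertex splits required to transform G into a cycle graph equals W*(G) − |V(G)|. -/
open SimpleGraph

/-! ### Cycle graphs and 2-regularity -/

lemma IsCycleGraph.ncard_neighborSet {W : Type} {H : SimpleGraph W} (h : IsCycleGraph H) (v : W) :
    (H.neighborSet v).ncard = 2 := by
  have hv := (h (H.connectedComponentMk v)).2 ⟨v, rfl⟩
  rw [← hv, ← Set.ncard_image_of_injective _ Subtype.val_injective]
  congr 1
  ext w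
  simp only [mem_neighborSet, Set.mem_image, comap_adj, Subtype.exists,
    Function.Embedding.subtype_apply, exists_and_left, exists_prop, exists_eq_right_right]
  constructor
  · intro hw
    exact ⟨hw, ConnectedComponent.sound hw.symm.reachable⟩
  · exact fun hw => hw.1

lemma isCycleGraph_of_ncard_neighborSet {W : Type} {H : SimpleGraph W}
    (h : ∀ v, (H.neighborSet v).ncard = 2) : IsCycleGraph H := by
  refine fun C => ⟨C.connected_toSimpleGraph, ?_⟩
  rintro ⟨v, hv⟩
  rw [← h v, ← Set.ncard_image_of_injective _ Subtype.val_injective]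
  congr 1
  ext w
  simp only [mem_neighborSet, Set.mem_image, comap_adj, Subtype.exists,
    Function.Embedding.subtype_apply, exists_and_left, exists_prop, exists_eq_right_right]
  constructor
  · exact fun hw => hw.1
  · intro hw
    refine ⟨hw, ?_⟩
    rw [ConnectedComponent.mem_supp_iff] at hv ⊢
    exact hv ▸ ConnectedComponent.sound hw.symm.reachable

/-! ### Covering homomorphisms -/

/-- A homomorphism that is surjective on vertices and on edges. -/
def IsCovering {W V : Type} {H : SimpleGraph W} {G : SimpleGraph V} (f : H →g G) : Prop :=
  Function.Surjective f ∧ ∀ x y, G.Adj x y → ∃ a b, H.Adj a b ∧ f a = x ∧ f b = y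

lemma IsCovering.id {V : Type} (G : SimpleGraph V) : IsCovering (Hom.id : G →g G) :=
  ⟨Function.surjective_id, fun x y hxy => ⟨x, y, hxy, rfl, rfl⟩⟩

lemma IsCovering.comp {W V U : Type} {H : SimpleGraph W} {G : SimpleGraph V} {K : SimpleGraph U}
    {g : G →g K} {f : H →g G} (hg : IsCovering g) (hf : IsCovering f) : IsCovering (g.comp f) := by
  refine ⟨hg.1.comp hf.1, fun x y hxy => ?_⟩
  obtain ⟨a, b, hab, rfl, rfl⟩ := hg.2 x y hxy
  obtain ⟨c, d, hcd, rfl, rfl⟩ := hf.2 a b hab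
  exact ⟨c, d, hcd, rfl, rfl⟩

lemma IsInclusiveSplit.exists_isCovering {V : Type} {G : SimpleGraph V}
    {G' : SimpleGraph (Option V)} {u : V} (h : IsInclusiveSplit G G' u) :
    ∃ f : G' →g G, IsCovering f := by
  obtain ⟨h1, h2, h3, h4, h5⟩ := h
  have hsome : ∀ x y : V, G'.Adj (some x) (some y) → G.Adj x y := by
    intro x y hxy
    by_cases hx : x = u
    · exact hx ▸ h3 y (hx ▸ hxy)
    by_cases hy : y = u
    · subst hy
      exact (h3 x hxy.symm).symm
    exact (h1 x y hx hy).1 hxy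
  have hlift : ∀ x, G.Adj u x → ∃ a b, G'.Adj a b ∧ a.getD u = u ∧ b.getD u = x := by
    intro x hx
    rcases h5 x hx with h | h
    · exact ⟨_, _, h, rfl, rfl⟩
    · exact ⟨_, _, h, rfl, rfl⟩
  refine ⟨⟨fun o => o.getD u, ?_⟩, fun x => ⟨some x, rfl⟩, fun x y hxy => ?_⟩
  · rintro (_ | x) (_ | y) hxy
    · exact (hxy.ne rfl).elim
    · exact h4 y hxy
    · exact (h4 x hxy.symm).symm
    · exact hsome x y hxy
  · by_cases hx : x = u
    · subst hx
      exact hlift y hxy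
    by_cases hy : y = u
    · subst hy
      obtain ⟨a, b, hab, ha, hb⟩ := hlift x hxy.symm
      exact ⟨b, a, hab.symm, hb, ha⟩
    exact ⟨some x, some y, (h1 x y hx hy).2 hxy, rfl, rfl⟩

lemma InclReach.exists_isCovering (k : ℕ) (V : Type) [Fintype V] (G : SimpleGraph V)
    (h : InclReach (fun _ H => IsCycleGraph H) k V G) :
    ∃ (W : Type) (_ : Fintype W) (H : SimpleGraph W) (f : H →g G), IsCovering f ∧
      IsCycleGraph H ∧ Fintype.card W ≤ k + Fintype.card V := by
  induction k generalizing V with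
  | zero => exact ⟨V, inferInstance, G, Hom.id, .id G, h, Nat.le_add_left _ _⟩
  | succ k ih =>
    rcases h with h | ⟨u, G', hs, h⟩
    · exact ⟨V, inferInstance, G, Hom.id, .id G, h, Nat.le_add_left _ _⟩
    · obtain ⟨W, hW, H, f, hf, hH, hc⟩ := ih (Option V) G' h
      obtain ⟨g, hg⟩ := hs.exists_isCovering
      refine ⟨W, hW, H, g.comp f, hg.comp hf, hH, ?_⟩
      rw [Fintype.card_option] at hc
      omega

/-- If two vertices of `H` lie over `u`, a covering factors through an inclusive split of `u`. -/
lemma IsCovering.exists_isInclusiveSplit {W V : Type} {H : SimpleGraph W} {G : SimpleGraph V}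
    {f : H →g G} (hf : IsCovering f) {a b : W} (hab : a ≠ b) (hfab : f a = f b) :
    ∃ (G' : SimpleGraph (Option V)) (f' : H →g G'), IsInclusiveSplit G G' (f a) ∧
      IsCovering f' := by
  classical
  let φ : W → Option V := fun w => if w = a then none else some (f w)
  have hφnone : ∀ w, φ w = none ↔ w = a := fun w => by simp [φ]
  have hφsome : ∀ w x, φ w = some x ↔ w ≠ a ∧ f w = x := fun w x => by simp [φ]
  have hnone : φ a = none := (hφnone a).2 rfl
  let G' : SimpleGraph (Option V) :=
    { Adj := fun x y => ∃ c d, H.Adj c d ∧ φ c = x ∧ φ d = y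
      symm := ⟨fun x y ⟨c, d, h, hc, hd⟩ => ⟨d, c, h.symm, hd, hc⟩⟩
      loopless := ⟨by
        rintro (_ | x) ⟨c, d, h, hc, hd⟩
        · rw [hφnone] at hc hd
          exact h.ne (hc.trans hd.symm)
        · rw [hφsome] at hc hd
          exact (f.map_adj h).ne (hc.2.trans hd.2.symm)⟩ }
  refine ⟨G', ⟨φ, fun {c d} h => ⟨c, d, h, rfl, rfl⟩⟩, ⟨?_, ?_, ?_, ?_, ?_⟩, ?_, ?_⟩
  · intro x y hx hy
    constructor
    · rintro ⟨c, d, h, hc, hd⟩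
      rw [hφsome] at hc hd
      exact hc.2 ▸ hd.2 ▸ f.map_adj h
    · intro h
      obtain ⟨c, d, hcd, rfl, rfl⟩ := hf.2 x y h
      exact ⟨c, d, hcd, (hφsome _ _).2 ⟨fun h => hx (h ▸ rfl), rfl⟩,
        (hφsome _ _).2 ⟨fun h => hy (h ▸ rfl), rfl⟩⟩
  · rintro ⟨c, d, h, hc, hd⟩
    rw [hφsome] at hc
    rw [hφnone] at hd
    exact (f.map_adj h).ne (hc.2.trans (hd ▸ rfl))
  · rintro x ⟨c, d, h, hc, hd⟩
    rw [hφsome] at hc hd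
    exact hc.2 ▸ hd.2 ▸ f.map_adj h
  · rintro x ⟨c, d, h, hc, hd⟩
    rw [hφnone] at hc
    rw [hφsome] at hd
    exact hc ▸ hd.2 ▸ f.map_adj h
  · intro x h
    obtain ⟨c, d, hcd, hc, rfl⟩ := hf.2 _ x h
    have hd : φ d = some (f d) := (hφsome _ _).2 ⟨fun hd => h.ne (hd ▸ rfl), rfl⟩
    by_cases hca : c = a
    · exact Or.inr ⟨c, d, hcd, (hφnone c).2 hca, hd⟩
    · exact Or.inl ⟨c, d, hcd, (hφsome _ _).2 ⟨hca, hc⟩, hd⟩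
  · rintro (_ | x)
    · exact ⟨a, hnone⟩
    · obtain ⟨w, rfl⟩ := hf.1 x
      by_cases hw : w = a
      · exact ⟨b, (hφsome _ _).2 ⟨hab.symm, by rw [hw, hfab]⟩⟩
      · exact ⟨w, (hφsome _ _).2 ⟨hw, rfl⟩⟩
  · rintro x y ⟨c, d, h, hc, hd⟩
    exact ⟨c, d, h, hc, hd⟩

lemma IsCovering.inclReach {W : Type} [Fintype W] {H : SimpleGraph W} (hH : IsCycleGraph H)
    (k : ℕ) (V : Type) [Fintype V] (G : SimpleGraph V) (f : H →g G) (hf : IsCovering f)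
    (hcard : Fintype.card W = k + Fintype.card V) :
    InclReach (fun _ H => IsCycleGraph H) k V G := by
  induction k generalizing V with
  | zero =>
    have hinj : Function.Injective f :=
      ((Fintype.bijective_iff_surjective_and_card f).2 ⟨hf.1, by omega⟩).1
    refine isCycleGraph_of_ncard_neighborSet fun v => ?_
    obtain ⟨w, rfl⟩ := hf.1 v
    rw [← hH.ncard_neighborSet w, ← Set.ncard_image_of_injective _ hinj]
    congr 1
    ext x
    constructor
    · intro h
      obtain ⟨c, d, hcd, hc, rfl⟩ := hf.2 _ _ h
      exact ⟨d, hinj hc ▸ hcd, rfl⟩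
    · rintro ⟨d, hd, rfl⟩
      exact f.map_adj hd
  | succ k ih =>
    obtain ⟨a, b, hab, hfab⟩ := Fintype.exists_ne_map_eq_of_card_lt f (by omega)
    obtain ⟨G', f', hs, hf'⟩ := hf.exists_isInclusiveSplit hab hfab
    exact Or.inr ⟨f a, G', hs, ih _ _ f' hf' (by rw [Fintype.card_option]; omega)⟩

/-! ### From covering cycle graphs to covering closed walks -/

/-- In a finite cycle graph every component is traversed by a closed walk whose length is the
number of vertices of the component. -/
lemma IsCycleGraph.exists_walk {W : Type} [Finite W] {H : SimpleGraph W} (hH : IsCycleGraph H)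
    (w : W) : ∃ p : H.Walk w w, p.length = (H.connectedComponentMk w).supp.ncard ∧
      ∀ a ∈ (H.connectedComponentMk w).supp, ∀ b, H.Adj a b → s(a, b) ∈ p.edges := by
  classical
  have hcyc : H.IsCycles := fun v _ => hH.ncard_neighborSet v
  obtain ⟨p, hp, hverts⟩ := hcyc.exists_cycle_toSubgraph_verts_eq_connectedComponentSupp
    (c := H.connectedComponentMk w) (v := w) rfl
    (Set.nonempty_of_ncard_ne_zero (by rw [hH.ncard_neighborSet w]; decide))
  refine ⟨p, ?_, fun a ha b hab => ?_⟩
  · rw [← hverts, Walk.verts_toSubgraph]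
    have : {x | x ∈ p.support} = (p.support.tail.toFinset : Set W) := by
      ext x
      simp only [Set.mem_ofPred_eq, List.coe_toFinset]
      rw [← Walk.cons_tail_support p, List.mem_cons]
      constructor
      · rintro (rfl | h)
        · exact Walk.end_mem_tail_support hp.not_nil
        · exact h
      · exact Or.inr
    rw [this, Set.ncard_coe_finset, List.toFinset_card_of_nodup hp.support_nodup]
    simp
  · rw [← Walk.adj_toSubgraph_iff_mem_edges]
    have ha' : a ∈ p.support := by
      rw [← Walk.mem_verts_toSubgraph, hverts]
      exact ha
    have heq : p.toSubgraph.neighborSet a = H.neighborSet a :=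
      Set.eq_of_subset_of_ncard_le (fun x hx => hx.adj_sub)
        (by rw [hH.ncard_neighborSet, hp.ncard_neighborSet_toSubgraph_eq_two ha'])
        (Set.toFinite _)
    have : b ∈ p.toSubgraph.neighborSet a := heq ▸ hab
    exact this

/-- In a connected graph covered by `H`, a nonempty proper union of components of `H` shares an
image vertex with its complement. -/
lemma IsCovering.exists_map_eq {W V : Type} {H : SimpleGraph W} {G : SimpleGraph V}
    (hG : G.Connected) {f : H →g G} (hf : IsCovering f) {S : Set W}
    (hS : ∀ a b, H.Adj a b → a ∈ S → b ∈ S) (hne : S.Nonempty) (hne' : S ≠ Set.univ) :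
    ∃ x ∈ S, ∃ y ∉ S, f x = f y := by
  obtain ⟨x, hx⟩ := hne
  obtain ⟨y, hy⟩ := (Set.ne_univ_iff_exists_notMem S).1 hne'
  by_contra! hcon
  have hstep : ∀ u v, G.Walk u v → u ∈ f '' S → v ∈ f '' S := by
    intro u v p
    induction p with
    | nil => exact fun h => h
    | cons h _ ih =>
      rintro ⟨a, ha, rfl⟩
      refine ih ?_
      obtain ⟨c, d, hcd, hc, rfl⟩ := hf.2 _ _ h
      by_cases hcS : c ∈ S
      · exact ⟨d, hS _ _ hcd hcS, rfl⟩
      · exact (hcon a ha c hcS hc.symm).elim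
  obtain ⟨p⟩ := hG.preconnected (f x) (f y)
  obtain ⟨z, hz, hzy⟩ := hstep _ _ p ⟨x, hx, rfl⟩
  exact hcon z hz y hy hzy

lemma IsCovering.exists_closed_walk {W V : Type} [Fintype W] {H : SimpleGraph W}
    {G : SimpleGraph V} (hG : G.Connected) (hH : IsCycleGraph H) {f : H →g G}
    (hf : IsCovering f) :
    ∃ (v : V) (p : G.Walk v v), (∀ e ∈ G.edgeSet, e ∈ p.edges) ∧ p.length = Fintype.card W := by
  classical
  have hcomp : ∀ w a b, H.Adj a b → a ∈ (H.connectedComponentMk w).supp →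
      b ∈ (H.connectedComponentMk w).supp := by
    intro w a b hab ha
    rw [ConnectedComponent.mem_supp_iff] at ha ⊢
    exact ha ▸ ConnectedComponent.sound hab.symm.reachable
  have hwalk : ∀ {S : Set W}, (∀ a b, H.Adj a b → a ∈ S → b ∈ S) →
      ∀ a b, H.Walk a b → a ∈ S → b ∈ S := by
    intro S hS a b r
    induction r with
    | nil => exact fun h => h
    | cons h _ ih => exact fun ha => ih (hS _ _ h ha)
  have key : ∀ (n : ℕ) (S : Set W) (v : V) (p : G.Walk v v), Sᶜ.ncard = n → S.Nonempty →
      (∀ a b, H.Adj a b → a ∈ S → b ∈ S) → p.length = S.ncard →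
      (∀ a ∈ S, ∀ b, H.Adj a b → s(f a, f b) ∈ p.edges) →
      ∃ (v : V) (p : G.Walk v v), (∀ e ∈ G.edgeSet, e ∈ p.edges) ∧
        p.length = Fintype.card W := by
    intro n
    induction n using Nat.strong_induction_on with
    | _ n ih =>
      intro S v p hn hne hS hlen hcov
      by_cases huniv : S = Set.univ
      · subst huniv
        refine ⟨v, p, ?_, by rw [hlen, Set.ncard_univ, Nat.card_eq_fintype_card]⟩
        intro e he
        induction e with
        | _ x y =>
          obtain ⟨a, b, hab, rfl, rfl⟩ := hf.2 x y he
          exact hcov a trivial b hab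
      obtain ⟨x, hx, y, hy, hxy⟩ := hf.exists_map_eq hG hS hne huniv
      obtain ⟨q, hqlen, hqcov⟩ := hH.exists_walk y
      set C := (H.connectedComponentMk y).supp with hC
      have hyC : y ∈ C := rfl
      have hdisj : Disjoint S C := by
        rw [Set.disjoint_left]
        intro z hzS hzC
        obtain ⟨r⟩ := ConnectedComponent.exact hzC
        exact hy (hwalk hS z y r hzS)
      have hyp : f y ∈ p.support := by
        obtain ⟨b, hb⟩ := Set.nonempty_of_ncard_ne_zero
          (s := H.neighborSet x) (by rw [hH.ncard_neighborSet x]; decide)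
        exact hxy ▸ Walk.fst_mem_support_of_mem_edges p (hcov x hx b hb)
      refine ih _ ?_ (S ∪ C) (f y) ((p.rotate _ hyp).append (q.map f)) rfl hne.inl ?_ ?_ ?_
      · rw [← hn]
        refine Set.ncard_lt_ncard ?_ (Set.toFinite _)
        refine compl_lt_compl_iff_lt.2 ?_
        exact ⟨Set.subset_union_left, fun h => hy (h (Or.inr hyC))⟩
      · rintro a b hab (ha | ha)
        · exact Or.inl (hS a b hab ha)
        · exact Or.inr (hcomp y a b hab ha)
      · rw [Walk.length_append, Walk.length_map, Walk.length_rotate, hlen, hqlen,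
          Set.ncard_union_eq hdisj]
      · rintro a (ha | ha) b hab
        · rw [Walk.edges_append, List.mem_append]
          exact Or.inl ((Walk.rotate_edges p _ hyp).mem_iff.2 (hcov a ha b hab))
        · rw [Walk.edges_append, List.mem_append, Walk.edges_map]
          exact Or.inr (List.mem_map.2 ⟨_, hqcov a ha b hab, rfl⟩)
  obtain ⟨v⟩ := hG.nonempty
  obtain ⟨w, -⟩ := hf.1 v
  obtain ⟨q, hqlen, hqcov⟩ := hH.exists_walk w
  refine key _ (H.connectedComponentMk w).supp (f w) (q.map f) rfl ⟨w, rfl⟩ (hcomp w) (by rw [Walk.length_map, hqlen]) ?_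
  intro a ha b hab
  rw [Walk.edges_map]
  exact List.mem_map.2 ⟨_, hqcov a ha b hab, rfl⟩

/-! ### From covering closed walks to covering cycle graphs -/

lemma isCycleGraph_cycleGraph (n : ℕ) : IsCycleGraph (cycleGraph (n + 3)) := by
  refine isCycleGraph_of_ncard_neighborSet fun v => ?_
  rw [← cycleGraph_degree_three_le (v := v), ← card_neighborSet_eq_degree,
    ← Nat.card_eq_fintype_card, Nat.card_coe_set_eq]

lemma three_le_length_of_covers {V : Type} {G : SimpleGraph V} (hE : 2 ≤ G.edgeSet.ncard) {v : V}
    (p : G.Walk v v) (hp : ∀ e ∈ G.edgeSet, e ∈ p.edges) : 3 ≤ p.length := by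
  have hsingle : ∀ e, ¬ G.edgeSet ⊆ {e} := by
    intro e he
    have := Set.ncard_le_ncard he
    rw [Set.ncard_singleton] at this
    omega
  match p, hp with
  | .nil, hp => exact (hsingle s(v, v) fun e he => by simpa using hp e he).elim
  | .cons h .nil, hp => exact (h.ne rfl).elim
  | .cons (v := w) h (.cons h' .nil), hp =>
    exact (hsingle s(v, w) fun e he => by simpa [Sym2.eq_swap] using hp e he).elim
  | .cons _ (.cons _ (.cons _ q)), hp => simp

lemma exists_isCovering_cycleGraph {V : Type} {G : SimpleGraph V} (hG : G.Connected)
    [Nontrivial V] {n : ℕ} {v : V} (p : G.Walk v v) (hp : ∀ e ∈ G.edgeSet, e ∈ p.edges)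
    (hlen : p.length = n + 3) : ∃ f : cycleGraph (n + 3) →g G, IsCovering f := by
  have hsucc : ∀ i : Fin (n + 3), p.getVert (i + 1 : Fin (n + 3)).val = p.getVert (i.val + 1) := by
    intro i
    rw [Fin.val_add_one]
    split_ifs with h
    · subst h
      rw [Fin.val_last, Walk.getVert_zero, ← hlen, Walk.getVert_length]
    · rfl
  have hadj : ∀ i : Fin (n + 3), G.Adj (p.getVert i.val) (p.getVert (i + 1 : Fin (n + 3)).val) := by
    intro i
    rw [hsucc]
    exact p.adj_getVert_succ (by omega)
  have hedge : ∀ x y, G.Adj x y → ∃ a b : Fin (n + 3), (cycleGraph (n + 3)).Adj a b ∧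
      p.getVert a = x ∧ p.getVert b = y := by
    intro x y hxy
    have hmem := hp s(x, y) hxy
    rw [← Walk.adj_toSubgraph_iff_mem_edges, Walk.toSubgraph_adj_iff] at hmem
    obtain ⟨i, hi, hil⟩ := hmem
    let j : Fin (n + 3) := ⟨i, by omega⟩
    have hj : (cycleGraph (n + 3)).Adj j (j + 1) := by simp [cycleGraph_adj]
    have hj1 : p.getVert (j + 1 : Fin (n + 3)).val = p.getVert (i + 1) := hsucc j
    rcases Sym2.eq_iff.1 hi with ⟨h1, h2⟩ | ⟨h1, h2⟩
    · exact ⟨j, j + 1, hj, h1, hj1.trans h2⟩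
    · exact ⟨j + 1, j, hj.symm, hj1.trans h2, h1⟩
  refine ⟨⟨fun i => p.getVert i.val, fun {a b} hab => ?_⟩, fun x => ?_, hedge⟩
  · rw [cycleGraph_adj] at hab
    rcases hab with h | h
    · rw [sub_eq_iff_eq_add'] at h
      subst h
      exact (hadj b).symm
    · rw [sub_eq_iff_eq_add'] at h
      subst h
      exact hadj a
  · obtain ⟨y, hy⟩ := hG.preconnected.exists_adj_of_nontrivial x
    obtain ⟨a, -, -, ha, -⟩ := hedge x y hy
    exact ⟨a, ha⟩

lemma exists_closed_walk_covers {V : Type} [Finite V] {G : SimpleGraph V} (hG : G.Connected) :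
    ∃ (v : V) (p : G.Walk v v), ∀ e ∈ G.edgeSet, e ∈ p.edges := by
  obtain ⟨v⟩ := hG.nonempty
  refine ⟨v, ?_⟩
  suffices h : ∀ S : Set (Sym2 V), S.Finite → S ⊆ G.edgeSet →
      ∃ p : G.Walk v v, ∀ e ∈ S, e ∈ p.edges from h _ (Set.toFinite _) subset_rfl
  intro S hS
  induction S, hS using Set.Finite.induction_on with
  | empty => exact fun _ => ⟨.nil, by simp⟩
  | @insert e S _ _ ih =>
    intro hsub
    obtain ⟨p, hp⟩ := ih ((Set.subset_insert _ _).trans hsub)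
    have he : e ∈ G.edgeSet := hsub (Set.mem_insert _ _)
    induction e with
    | _ a b =>
      rw [mem_edgeSet] at he
      obtain ⟨q⟩ := hG.preconnected v a
      obtain ⟨r⟩ := hG.preconnected b v
      refine ⟨p.append (q.append (.cons he r)), ?_⟩
      rintro e (rfl | h)
      · simp
      · simp [hp e h]

/-- Let `G` be a connected finite simple graph with at least two
edges, and let `W*(G)` be the minimum length of a closed walk traversing every edge of
`G` at least once.  Then the minimum number of inclusive vertex splits required to
transform `G` into a cycle graph equals `W*(G) - |V(G)|` (stated additively). -/
theorem minInclusiveSplits_eq_chinesePostman {V : Type} [Fintype V] (G : SimpleGraph V)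
    (hconn : G.Connected) (hE : 2 ≤ G.edgeSet.ncard) :
    sInf {k : ℕ | InclReach (fun _ H => IsCycleGraph H) k V G} + Fintype.card V
      = sInf {l : ℕ | ∃ (v : V) (p : G.Walk v v),
          (∀ e ∈ G.edgeSet, e ∈ p.edges) ∧ p.length = l} := by
  have hnt : Nontrivial V := by
    have hne : G.edgeSet.Nonempty := Set.nonempty_of_ncard_ne_zero (by omega)
    obtain ⟨e, he⟩ := hne
    induction e with
    | _ a b => exact ⟨a, b, G.ne_of_adj he⟩
  set A := {k : ℕ | InclReach (fun _ H => IsCycleGraph H) k V G} with hA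
  set B := {l : ℕ | ∃ (v : V) (p : G.Walk v v),
    (∀ e ∈ G.edgeSet, e ∈ p.edges) ∧ p.length = l} with hB
  have hBA : ∀ l ∈ B, ∃ k ∈ A, l = k + Fintype.card V := by
    rintro l ⟨v, p, hp, rfl⟩
    obtain ⟨n, hn⟩ := Nat.exists_eq_add_of_le' (three_le_length_of_covers hE p hp)
    obtain ⟨f, hf⟩ := exists_isCovering_cycleGraph hconn p hp hn
    have hle := Fintype.card_le_of_surjective f hf.1
    rw [Fintype.card_fin] at hle
    refine ⟨n + 3 - Fintype.card V, hf.inclReach (isCycleGraph_cycleGraph n) _ _ _ _ ?_, by omega⟩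
    rw [Fintype.card_fin]
    omega
  have hAB : ∀ k ∈ A, ∃ l ∈ B, l ≤ k + Fintype.card V := by
    intro k hk
    obtain ⟨W, _, H, f, hf, hH, hc⟩ := InclReach.exists_isCovering k V G hk
    exact ⟨_, hf.exists_closed_walk hconn hH, hc⟩
  have hBne : B.Nonempty := by
    obtain ⟨v, p, hp⟩ := exists_closed_walk_covers hconn
    exact ⟨_, v, p, hp, rfl⟩
  obtain ⟨k, hk, hkB⟩ := hBA _ (Nat.sInf_mem hBne)
  obtain ⟨l, hl, hlA⟩ := hAB _ (Nat.sInf_mem ⟨k, hk⟩)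
  have := Nat.sInf_le hk
  have := Nat.sInf_le hl
  omega
end
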